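/- arXiv:math/9810150 — 2 statements merged into one kernel-verified Lean document; each statement's English description precedes it below -/
import Mathlib

section
/- Let n ≥ 0 and r ≥ 1 be integers. The ℤ-algebra homomorphism ℤ[k,η] → ℤ[h,ξ] determined by k ↦ ξ − h and η ↦ ξ − 2h induces a ring isomorphism ℤ[k,η]/((k−η)^(n+1), k^(r−1)·η) ≅ ℤ[h,ξ]/(h^(n+1), (ξ−h)^(r−1)·(ξ−2h)). (This is the algebraic content of the identification of the classical cohomology ring of the blow-up of ℙ^m along a p-dimensional linear subspace, presented with generators k (hyperplane class) and η (exceptional divisor) and relations g₁ = (k−η)^(m−p), g₂ = k^(p+1)·η, with the cohomology ring of the projective bundle P(V) over ℙⁿ, where n = m−p−1 and r = p+2, presented with generators h, ξ and relations f₁ = h^(n+1), f₂ = (ξ−h)^(r−1)(ξ−2h).) -/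
open MvPolynomial

/-- The ideal `((k−η)^(n+1), k^(r−1)·η)` of `ℤ[k,η]` (with `k = X 0`, `η = X 1`):
the classical cohomology relations of the blow-up. -/
noncomputable def blowupIdeal (n r : ℕ) : Ideal (MvPolynomial (Fin 2) ℤ) :=
  Ideal.span {(X 0 - X 1) ^ (n + 1), X 0 ^ (r - 1) * X 1}

/-- The ideal `(h^(n+1), (ξ−h)^(r−1)·(ξ−2h))` of `ℤ[h,ξ]` (with `h = X 0`, `ξ = X 1`):
the classical cohomology relations of the projective bundle `P(V)`. -/
noncomputable def bundleIdeal (n r : ℕ) : Ideal (MvPolynomial (Fin 2) ℤ) :=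
  Ideal.span {X 0 ^ (n + 1), (X 1 - X 0) ^ (r - 1) * (X 1 - 2 * X 0)}

/-- The map `k ↦ ξ − h`, `η ↦ ξ − 2h` induces a ring isomorphism
`ℤ[k,η]/((k−η)^(n+1), k^(r−1)η) ≅ ℤ[h,ξ]/(h^(n+1), (ξ−h)^(r−1)(ξ−2h))`. -/
theorem classical_cohomology_iso (n r : ℕ) (hn : 0 ≤ n) (hr : 1 ≤ r) :
    ∃ e : (MvPolynomial (Fin 2) ℤ ⧸ blowupIdeal n r) ≃+*
          (MvPolynomial (Fin 2) ℤ ⧸ bundleIdeal n r),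
      ∀ q : MvPolynomial (Fin 2) ℤ,
        e (Ideal.Quotient.mk (blowupIdeal n r) q) =
          Ideal.Quotient.mk (bundleIdeal n r) (aeval ![X 1 - X 0, X 1 - 2 * X 0] q) := by
  have h1 : (aeval ![X 1 - X 0, X 1 - 2 * X 0] :
      MvPolynomial (Fin 2) ℤ →ₐ[ℤ] MvPolynomial (Fin 2) ℤ).comp
      (aeval ![X 0 - X 1, 2 * X 0 - X 1]) = AlgHom.id ℤ _ := by
    apply MvPolynomial.algHom_ext
    intro i
    fin_cases i <;> simp [map_ofNat] <;> ring
  have h2 : (aeval ![X 0 - X 1, 2 * X 0 - X 1] :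
      MvPolynomial (Fin 2) ℤ →ₐ[ℤ] MvPolynomial (Fin 2) ℤ).comp
      (aeval ![X 1 - X 0, X 1 - 2 * X 0]) = AlgHom.id ℤ _ := by
    apply MvPolynomial.algHom_ext
    intro i
    fin_cases i <;> simp [map_ofNat] <;> ring
  let f : MvPolynomial (Fin 2) ℤ ≃ₐ[ℤ] MvPolynomial (Fin 2) ℤ :=
    AlgEquiv.ofAlgHom _ _ h1 h2
  have hf : ∀ q, f q = aeval ![X 1 - X 0, X 1 - 2 * X 0] q := fun q => rfl
  have e1 : (X 1 - X 0 - (X 1 - 2 * X 0) : MvPolynomial (Fin 2) ℤ) = X 0 := by ring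
  refine ⟨Ideal.quotientEquiv (blowupIdeal n r) (bundleIdeal n r) f.toRingEquiv ?_, ?_⟩
  · have hf' : ∀ q, (f.toRingEquiv : MvPolynomial (Fin 2) ℤ →+* MvPolynomial (Fin 2) ℤ) q
        = aeval ![X 1 - X 0, X 1 - 2 * X 0] q := fun q => rfl
    rw [blowupIdeal, bundleIdeal, Ideal.map_span, Set.image_pair, hf', hf']
    simp [e1]
  · intro q
    rfl
end

section
/- Let m and p be integers with 0 ≤ p and p + 1 ≤ m. The ring ℤ[k,η]/((k−η)^(m−p) − η, k^(p+1)·η − 1) is isomorphic to ℤ[X]/((X^(m−p) + X)^(p+1) · X^(m−p) − 1), via the map induced by k ↦ X^(m−p) + X and η ↦ X^(m−p). (This gives a one-variable presentation of the ring ℤ[k,η]/(g̃₁, g̃₂), with g̃₁ = (k−η)^(m−p) − η and g̃₂ = k^(p+1)·η − 1, which by the Main Theorem is the quantum cohomology ring of the blow-up of ℙ^m along a p-dimensional linear subspace when 2p + 3 < m.) -/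
open MvPolynomial

/-- The ideal `((k−η)^(m−p) − η, k^(p+1)·η − 1)` of `ℤ[k,η]` (with `k = X 0`,
`η = X 1`): the quantum cohomology relations of the blow-up of `ℙ^m` along a
`p`-dimensional linear subspace. -/
noncomputable def qBlowupIdeal (m p : ℕ) : Ideal (MvPolynomial (Fin 2) ℤ) :=
  Ideal.span {(X 0 - X 1) ^ (m - p) - X 1, X 0 ^ (p + 1) * X 1 - 1}

/-- The ideal `((X^(m−p) + X)^(p+1) · X^(m−p) − 1)` of `ℤ[X]`. -/
noncomputable def qOneVarIdeal (m p : ℕ) : Ideal (Polynomial ℤ) :=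
  Ideal.span {(Polynomial.X ^ (m - p) + Polynomial.X) ^ (p + 1) * Polynomial.X ^ (m - p) - 1}

/-- One-variable presentation of the quantum cohomology ring of the blow-up:
the map `k ↦ X^(m−p) + X`, `η ↦ X^(m−p)` induces a ring isomorphism
`ℤ[k,η]/((k−η)^(m−p) − η, k^(p+1)η − 1) ≅ ℤ[X]/((X^(m−p) + X)^(p+1)·X^(m−p) − 1)`. -/
theorem quantum_one_var_presentation (m p : ℕ) (hp : 0 ≤ p) (hm : p + 1 ≤ m) :
    ∃ e : (MvPolynomial (Fin 2) ℤ ⧸ qBlowupIdeal m p) ≃+* (Polynomial ℤ ⧸ qOneVarIdeal m p),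
      ∀ q : MvPolynomial (Fin 2) ℤ,
        e (Ideal.Quotient.mk (qBlowupIdeal m p) q) =
          Ideal.Quotient.mk (qOneVarIdeal m p)
            (aeval ![Polynomial.X ^ (m - p) + Polynomial.X, Polynomial.X ^ (m - p)] q) := by
  let I := qBlowupIdeal m p
  let J := qOneVarIdeal m p
  let v : Fin 2 → Polynomial ℤ :=
    ![Polynomial.X ^ (m - p) + Polynomial.X, Polynomial.X ^ (m - p)]
  let f0 : MvPolynomial (Fin 2) ℤ →+* Polynomial ℤ ⧸ J :=
    (Ideal.Quotient.mk J).comp (aeval v : MvPolynomial (Fin 2) ℤ →ₐ[ℤ] Polynomial ℤ).toRingHom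
  let g0 : Polynomial ℤ →+* MvPolynomial (Fin 2) ℤ ⧸ I :=
    (Ideal.Quotient.mk I).comp
      (Polynomial.aeval (X 0 - X 1 : MvPolynomial (Fin 2) ℤ)).toRingHom
  have h1 : (Ideal.Quotient.mk I (X 0) - Ideal.Quotient.mk I (X 1)) ^ (m - p)
      = Ideal.Quotient.mk I (X 1) := by
    rw [← map_sub, ← map_pow, Ideal.Quotient.eq]
    exact Ideal.subset_span (by simp)
  have h2 : Ideal.Quotient.mk I (X 0) ^ (p + 1) * Ideal.Quotient.mk I (X 1) = 1 := by
    rw [← map_pow, ← map_mul, ← map_one (Ideal.Quotient.mk I), Ideal.Quotient.eq]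
    exact Ideal.subset_span (by simp)
  have hf : ∀ a ∈ I, f0 a = 0 := by
    intro a ha
    have : I ≤ RingHom.ker f0 := by
      refine Ideal.span_le.2 ?_
      rintro x (rfl | rfl)
      · simp [RingHom.mem_ker, f0, v]
      · change Ideal.Quotient.mk J _ = 0
        rw [Ideal.Quotient.eq_zero_iff_mem]
        refine Ideal.subset_span ?_
        simp [v]
    exact this ha
  have hg : ∀ a ∈ J, g0 a = 0 := by
    intro a ha
    have : J ≤ RingHom.ker g0 := by
      refine Ideal.span_le.2 ?_
      rintro x rfl
      simp [RingHom.mem_ker, g0, h1, h2]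
    exact this ha
  refine ⟨RingEquiv.ofRingHom (Ideal.Quotient.lift I f0 hf) (Ideal.Quotient.lift J g0 hg)
    ?_ ?_, fun q => rfl⟩
  · apply Ideal.Quotient.ringHom_ext
    apply Polynomial.ringHom_ext
    · intro a; simp
    · have hX : g0 Polynomial.X = Ideal.Quotient.mk I (X 0 - X 1) := by simp [g0]
      change Ideal.Quotient.lift I f0 hf (g0 Polynomial.X) = Ideal.Quotient.mk J Polynomial.X
      rw [hX]
      change f0 (X 0 - X 1) = _
      simp [f0, v]
  · apply Ideal.Quotient.ringHom_ext
    apply MvPolynomial.ringHom_ext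
    · intro a; simp
    · intro i
      change g0 (aeval v (X i)) = Ideal.Quotient.mk I (X i)
      fin_cases i <;> simp [g0, v, h1]
end
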